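/- In the near-separable setting with m = r, assume r ≥ 2 and ε ≤ σ_min(W)/(8 r √r). Let A* be an optimal solution of the minimum-volume-ellipsoid SDP associated with M̃ and let Q ∈ ℝ^{r×r} satisfy QᵀQ = A*. Then: σ_min(QW) ≥ 1/√10, κ(QW) ≤ √40, σ_min(Q) ≥ 1/(√10 · σ_max(W)), σ_max(Q) ≤ 2/σ_min(W), and κ(Q) ≤ 2√10 · κ(W). -/

import Mathlib

open Matrix BigOperators

/-- Euclidean norm of a vector in `ℝ^m`. -/
noncomputable def colNorm {m : ℕ} (v : Fin m → ℝ) : ℝ := Real.sqrt (∑ i, (v i) ^ 2)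

/-- Largest singular value of a matrix. -/
noncomputable def sigmaMax {m n : ℕ} (X : Matrix (Fin m) (Fin n) ℝ) : ℝ :=
  sSup {c : ℝ | ∃ v : Fin n → ℝ, colNorm v = 1 ∧ c = colNorm (X.mulVec v)}

/-- Smallest singular value of a matrix. -/
noncomputable def sigmaMin {m n : ℕ} (X : Matrix (Fin m) (Fin n) ℝ) : ℝ :=
  sInf {c : ℝ | ∃ v : Fin n → ℝ, colNorm v = 1 ∧ c = colNorm (X.mulVec v)}

/-- Condition number `κ(X) = σ_max(X) / σ_min(X)`. -/
noncomputable def kappa {m n : ℕ} (X : Matrix (Fin m) (Fin n) ℝ) : ℝ :=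
  sigmaMax X / sigmaMin X

/-- Largest eigenvalue of a symmetric matrix, via the Rayleigh quotient. -/
noncomputable def lamMax {r : ℕ} (C : Matrix (Fin r) (Fin r) ℝ) : ℝ :=
  sSup {c : ℝ | ∃ v : Fin r → ℝ, colNorm v = 1 ∧ c = v ⬝ᵥ C.mulVec v}

/-- Smallest eigenvalue of a symmetric matrix, via the Rayleigh quotient. -/
noncomputable def lamMin {r : ℕ} (C : Matrix (Fin r) (Fin r) ℝ) : ℝ :=
  sInf {c : ℝ | ∃ v : Fin r → ℝ, colNorm v = 1 ∧ c = v ⬝ᵥ C.mulVec v}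

/-- Near-separable assumption with `m = r`: `Mt = W * H + N` where `W ∈ ℝ^{r×r}` is
invertible, `H = [I_r, H']` is nonnegative with column sums at most one and whose first `r`
columns form the identity matrix, and each column of `N` has Euclidean norm at most `ε`. -/
def NearSepSquare (r n : ℕ) (W : Matrix (Fin r) (Fin r) ℝ) (H : Matrix (Fin r) (Fin n) ℝ)
    (N Mt : Matrix (Fin r) (Fin n) ℝ) (ε : ℝ) : Prop :=
  IsUnit W.det ∧ Mt = W * H + N ∧ (∀ i j, 0 ≤ H i j) ∧ (∀ j, ∑ i, H i j ≤ 1) ∧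
    (∃ h : r ≤ n, ∀ i j : Fin r, H i (Fin.castLE h j) = if i = j then 1 else 0) ∧
    0 ≤ ε ∧ ∀ j, colNorm (fun i => N i j) ≤ ε

/-- `A` is feasible for the minimum-volume-ellipsoid SDP associated with `Mt`:
`A` is positive semidefinite and `m̃ᵢᵀ A m̃ᵢ ≤ 1` for every column `m̃ᵢ` of `Mt`. -/
def SDPFeasible {r n : ℕ} (Mt : Matrix (Fin r) (Fin n) ℝ)
    (A : Matrix (Fin r) (Fin r) ℝ) : Prop :=
  A.PosSemidef ∧ ∀ j : Fin n, (fun i => Mt i j) ⬝ᵥ A.mulVec (fun i => Mt i j) ≤ 1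

/-- `A` is an optimal solution of the minimum-volume-ellipsoid SDP associated with `Mt`:
it is feasible and maximizes the determinant among the feasible matrices. -/
def SDPOptimal {r n : ℕ} (Mt : Matrix (Fin r) (Fin n) ℝ)
    (A : Matrix (Fin r) (Fin r) ℝ) : Prop :=
  SDPFeasible Mt A ∧ ∀ B : Matrix (Fin r) (Fin r) ℝ, SDPFeasible Mt B → B.det ≤ A.det

lemma colNorm_eq_norm {m : ℕ} (v : Fin m → ℝ) : colNorm v = ‖WithLp.toLp 2 v‖ := by
  simp [colNorm, EuclideanSpace.norm_eq]

lemma colNorm_nonneg {m : ℕ} (v : Fin m → ℝ) : 0 ≤ colNorm v := Real.sqrt_nonneg _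

lemma colNorm_sq {m : ℕ} (v : Fin m → ℝ) : colNorm v ^ 2 = v ⬝ᵥ v := by
  rw [colNorm, Real.sq_sqrt (by positivity)]
  simp [dotProduct, sq]

lemma colNorm_add_le {m : ℕ} (v w : Fin m → ℝ) : colNorm (v + w) ≤ colNorm v + colNorm w := by
  simpa only [colNorm_eq_norm, WithLp.toLp_add] using norm_add_le _ _

lemma colNorm_sub_le {m : ℕ} (v w : Fin m → ℝ) : colNorm (v - w) ≤ colNorm v + colNorm w := by
  simpa only [colNorm_eq_norm, WithLp.toLp_sub] using norm_sub_le _ _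

lemma colNorm_smul {m : ℕ} (c : ℝ) (v : Fin m → ℝ) : colNorm (c • v) = |c| * colNorm v := by
  simp only [colNorm_eq_norm, WithLp.toLp_smul, norm_smul, Real.norm_eq_abs]

lemma colNorm_eq_zero {m : ℕ} {v : Fin m → ℝ} : colNorm v = 0 ↔ v = 0 := by
  simp [colNorm_eq_norm]

lemma colNorm_single {m : ℕ} (i : Fin m) : colNorm (Pi.single i (1 : ℝ)) = 1 := by
  rw [← sq_eq_sq₀ (colNorm_nonneg _) zero_le_one, colNorm_sq]
  simp

lemma colNorm_le_sum {m : ℕ} {v : Fin m → ℝ} (hv : ∀ i, 0 ≤ v i) : colNorm v ≤ ∑ i, v i := by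
  rw [colNorm]
  exact Real.sqrt_le_iff.2 ⟨Finset.sum_nonneg fun i _ => hv i,
    Finset.sum_sq_le_sq_sum_of_nonneg fun i _ => hv i⟩

lemma colNorm_mulVec_sq {m n : ℕ} (X : Matrix (Fin m) (Fin n) ℝ) (v : Fin n → ℝ) :
    colNorm (X *ᵥ v) ^ 2 = v ⬝ᵥ (Xᵀ * X) *ᵥ v := by
  rw [colNorm_sq, ← Matrix.mulVec_mulVec, Matrix.dotProduct_mulVec v, Matrix.vecMul_transpose]

lemma trace_transpose_mul_self {m n : ℕ} (X : Matrix (Fin m) (Fin n) ℝ) :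
    (Xᵀ * X).trace = ∑ i, colNorm (X *ᵥ Pi.single i 1) ^ 2 := by
  refine Finset.sum_congr rfl fun i _ => ?_
  rw [colNorm_mulVec_sq]
  simp

lemma colNorm_mulVec_le_frobenius {m n : ℕ} (X : Matrix (Fin m) (Fin n) ℝ) (v : Fin n → ℝ) :
    colNorm (X *ᵥ v) ≤ √(Xᵀ * X).trace * colNorm v := by
  have htr : (Xᵀ * X).trace = ∑ i, ∑ j, X i j ^ 2 := by
    simp only [Matrix.trace, Matrix.diag, Matrix.mul_apply, Matrix.transpose_apply, ← sq]
    exact Finset.sum_comm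
  rw [htr, colNorm, colNorm, ← Real.sqrt_mul (by positivity), Finset.sum_mul]
  exact Real.sqrt_le_sqrt (Finset.sum_le_sum fun i _ =>
    Finset.sum_mul_sq_le_sq_mul_sq Finset.univ (X i) v)

lemma sigmaMin_mul_le {m n : ℕ} (X : Matrix (Fin m) (Fin n) ℝ) (v : Fin n → ℝ) :
    sigmaMin X * colNorm v ≤ colNorm (X *ᵥ v) := by
  rcases eq_or_ne v 0 with rfl | hv
  · simp [colNorm_eq_zero.2]
  have hpos : 0 < colNorm v := (colNorm_nonneg v).lt_of_ne' (mt colNorm_eq_zero.1 hv)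
  rw [← le_div_iff₀ hpos]
  refine csInf_le ⟨0, ?_⟩ ⟨(colNorm v)⁻¹ • v, ?_, ?_⟩
  · rintro _ ⟨w, -, rfl⟩
    exact colNorm_nonneg _
  · rw [colNorm_smul, abs_of_pos (inv_pos.2 hpos), inv_mul_cancel₀ hpos.ne']
  · rw [Matrix.mulVec_smul, colNorm_smul, abs_of_pos (inv_pos.2 hpos), div_eq_inv_mul]

lemma le_sigmaMax_mul {m n : ℕ} (X : Matrix (Fin m) (Fin n) ℝ) (v : Fin n → ℝ) :
    colNorm (X *ᵥ v) ≤ sigmaMax X * colNorm v := by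
  rcases eq_or_ne v 0 with rfl | hv
  · simp [colNorm_eq_zero.2]
  have hpos : 0 < colNorm v := (colNorm_nonneg v).lt_of_ne' (mt colNorm_eq_zero.1 hv)
  rw [← div_le_iff₀ hpos]
  refine le_csSup ⟨√(Xᵀ * X).trace, ?_⟩ ⟨(colNorm v)⁻¹ • v, ?_, ?_⟩
  · rintro _ ⟨w, hw, rfl⟩
    simpa [hw] using colNorm_mulVec_le_frobenius X w
  · rw [colNorm_smul, abs_of_pos (inv_pos.2 hpos), inv_mul_cancel₀ hpos.ne']
  · rw [Matrix.mulVec_smul, colNorm_smul, abs_of_pos (inv_pos.2 hpos), div_eq_inv_mul]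

lemma le_sigmaMin {m n : ℕ} (hn : 0 < n) {X : Matrix (Fin m) (Fin n) ℝ} {c : ℝ}
    (h : ∀ v, c * colNorm v ≤ colNorm (X *ᵥ v)) : c ≤ sigmaMin X := by
  refine le_csInf ⟨_, Pi.single ⟨0, hn⟩ 1, colNorm_single _, rfl⟩ ?_
  rintro _ ⟨v, hv, rfl⟩
  simpa [hv] using h v

lemma sigmaMax_le {m n : ℕ} (hn : 0 < n) {X : Matrix (Fin m) (Fin n) ℝ} {c : ℝ}
    (h : ∀ v, colNorm (X *ᵥ v) ≤ c * colNorm v) : sigmaMax X ≤ c := by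
  refine csSup_le ⟨_, Pi.single ⟨0, hn⟩ 1, colNorm_single _, rfl⟩ ?_
  rintro _ ⟨v, hv, rfl⟩
  simpa [hv] using h v

lemma sigmaMin_le_sigmaMax {m n : ℕ} (hn : 0 < n) (X : Matrix (Fin m) (Fin n) ℝ) :
    sigmaMin X ≤ sigmaMax X := by
  have h := (sigmaMin_mul_le X _).trans (le_sigmaMax_mul X (Pi.single ⟨0, hn⟩ 1))
  simpa [colNorm_single] using h

lemma sigmaMin_pos {r : ℕ} (hr : 0 < r) {W : Matrix (Fin r) (Fin r) ℝ} (hW : IsUnit W.det) :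
    0 < sigmaMin W := by
  have key : ∀ v, colNorm v ≤ sigmaMax W⁻¹ * colNorm (W *ᵥ v) := fun v => by
    simpa [Matrix.mulVec_mulVec, Matrix.nonsing_inv_mul W hW] using le_sigmaMax_mul W⁻¹ (W *ᵥ v)
  have hpos : 0 < sigmaMax W⁻¹ := by
    have h1 := key (Pi.single ⟨0, hr⟩ 1)
    rw [colNorm_single] at h1
    exact pos_of_mul_pos_left (zero_lt_one.trans_le h1) (colNorm_nonneg _)
  refine (inv_pos.2 hpos).trans_le (le_sigmaMin hr fun v => ?_)
  rw [inv_mul_le_iff₀ hpos]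
  exact key v

lemma bounds_of_sub_one_sub_log_le {x : ℝ} (hx : 0 < x) (h : x - 1 - Real.log x ≤ 11 / 20) :
    1 / 10 ≤ x ∧ x ≤ 4 := by
  have hl2 := Real.log_two_gt_d9
  have hu2 := Real.log_two_lt_d9
  constructor
  · by_contra! hlt
    have h8 : Real.log x ≤ Real.log ((2 ^ 3)⁻¹) := Real.log_le_log hx (by norm_num; linarith)
    rw [Real.log_inv, Real.log_pow] at h8
    push_cast at h8
    linarith
  · by_contra! hlt
    have h4 := Real.log_le_sub_one_of_pos (show 0 < x / 2 ^ 2 by positivity)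
    rw [Real.log_div hx.ne' (by norm_num), Real.log_pow] at h4
    push_cast at h4
    linarith

lemma eigenvalues_mem_Icc_of_trace_det {r : ℕ} {C : Matrix (Fin r) (Fin r) ℝ} (hC : C.PosSemidef)
    (htr : C.trace ≤ r + 3 / 10) (hdet : Real.exp (-(1 / 4)) ≤ C.det) (i : Fin r) :
    1 / 10 ≤ hC.1.eigenvalues i ∧ hC.1.eigenvalues i ≤ 4 := by
  have hprod : C.det = ∏ j, hC.1.eigenvalues j := by simpa using hC.1.det_eq_prod_eigenvalues
  have hsum : C.trace = ∑ j, hC.1.eigenvalues j := by simpa using hC.1.trace_eq_sum_eigenvalues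
  have hdpos : 0 < C.det := (Real.exp_pos _).trans_le hdet
  have hne : ∀ j, hC.1.eigenvalues j ≠ 0 := fun j =>
    Finset.prod_ne_zero_iff.1 (hprod ▸ hdpos.ne') j (Finset.mem_univ j)
  have hpos : ∀ j, 0 < hC.1.eigenvalues j := fun j =>
    (hC.eigenvalues_nonneg j).lt_of_ne' (hne j)
  have hlog : -(1 / 4) ≤ ∑ j, Real.log (hC.1.eigenvalues j) := by
    rw [← Real.log_prod fun j _ => hne j, ← hprod]
    exact (Real.le_log_iff_exp_le hdpos).2 hdet
  refine bounds_of_sub_one_sub_log_le (hpos i) ?_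
  calc hC.1.eigenvalues i - 1 - Real.log (hC.1.eigenvalues i)
      ≤ ∑ j, (hC.1.eigenvalues j - 1 - Real.log (hC.1.eigenvalues j)) :=
        Finset.single_le_sum (f := fun j => hC.1.eigenvalues j - 1 - Real.log (hC.1.eigenvalues j))
          (fun j _ => sub_nonneg.2 (Real.log_le_sub_one_of_pos (hpos j))) (Finset.mem_univ i)
    _ ≤ 11 / 20 := by
        simp only [Finset.sum_sub_distrib, Finset.sum_const, Finset.card_univ, Fintype.card_fin,
          nsmul_eq_mul, mul_one]
        linarith

lemma quadForm_bounds_of_eigenvalues {r : ℕ} {C : Matrix (Fin r) (Fin r) ℝ} (hC : C.IsHermitian)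
    {a b : ℝ} (h : ∀ i, a ≤ hC.eigenvalues i ∧ hC.eigenvalues i ≤ b) (v : Fin r → ℝ) :
    a * (v ⬝ᵥ v) ≤ v ⬝ᵥ C *ᵥ v ∧ v ⬝ᵥ C *ᵥ v ≤ b * (v ⬝ᵥ v) := by
  have hherm : ∀ c : ℝ, (algebraMap ℝ (Matrix (Fin r) (Fin r) ℝ) c).IsHermitian := fun c => by
    rw [Matrix.algebraMap_eq_diagonal]
    exact Matrix.isHermitian_diagonal _
  have hmul : ∀ c : ℝ, v ⬝ᵥ algebraMap ℝ (Matrix (Fin r) (Fin r) ℝ) c *ᵥ v = c * (v ⬝ᵥ v) :=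
    fun c => by
      rw [Algebra.algebraMap_eq_smul_one, Matrix.smul_mulVec, Matrix.one_mulVec, dotProduct_smul,
        smul_eq_mul]
  have hlow : (C - algebraMap ℝ _ a).PosSemidef := by
    refine Matrix.posSemidef_iff_isHermitian_and_spectrum_nonneg.2 ⟨hC.sub (hherm a), ?_⟩
    rw [← spectrum.sub_singleton_eq, hC.spectrum_real_eq_range_eigenvalues]
    rintro _ ⟨_, ⟨i, rfl⟩, _, rfl, rfl⟩
    exact sub_nonneg.2 (h i).1
  have hupp : (algebraMap ℝ _ b - C).PosSemidef := by
    refine Matrix.posSemidef_iff_isHermitian_and_spectrum_nonneg.2 ⟨(hherm b).sub hC, ?_⟩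
    rw [← spectrum.singleton_sub_eq, hC.spectrum_real_eq_range_eigenvalues]
    rintro _ ⟨_, rfl, _, ⟨i, rfl⟩, rfl⟩
    exact sub_nonneg.2 (h i).2
  have h1 := hlow.dotProduct_mulVec_nonneg v
  have h2 := hupp.dotProduct_mulVec_nonneg v
  rw [star_trivial, Matrix.sub_mulVec, dotProduct_sub, hmul] at h1 h2
  exact ⟨by linarith, by linarith⟩

lemma trace_le_of_colNorm_le {r : ℕ} (hr : 2 ≤ r) {R : Matrix (Fin r) (Fin r) ℝ}
    {u : Fin r → Fin r → ℝ} {δ : ℝ} (hδ : δ * (8 * r * √r) ≤ 1) (hu : ∀ i, colNorm (u i) ≤ δ)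
    (hR : ∀ i, colNorm (R *ᵥ (Pi.single i 1 + u i)) ≤ 1) :
    (Rᵀ * R).trace ≤ r + 3 / 10 := by
  set F := √(Rᵀ * R).trace with hF
  have htr := trace_transpose_mul_self R
  have hF0 : 0 ≤ F := Real.sqrt_nonneg _
  have hFsq : F ^ 2 = (Rᵀ * R).trace := Real.sq_sqrt (by rw [htr]; positivity)
  have hδ0 : 0 ≤ δ := (colNorm_nonneg _).trans (hu ⟨0, by omega⟩)
  have hcol : ∀ i, colNorm (R *ᵥ Pi.single i 1) ≤ 1 + F * δ := fun i => by
    have h1 := colNorm_sub_le (R *ᵥ (Pi.single i 1 + u i)) (R *ᵥ u i)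
    rw [← Matrix.mulVec_sub, add_sub_cancel_right] at h1
    have h2 := colNorm_mulVec_le_frobenius R (u i)
    have h3 := mul_le_mul_of_nonneg_left (hu i) hF0
    linarith [hR i]
  have hr2 : (2 : ℝ) ≤ r := by exact_mod_cast hr
  have hs0 : 0 ≤ √(r : ℝ) := Real.sqrt_nonneg _
  have hs : √(r : ℝ) ^ 2 = r := Real.sq_sqrt (by positivity)
  have hle : F ^ 2 ≤ (√r * (1 + F * δ)) ^ 2 := by
    rw [hFsq, htr, mul_pow, hs]
    calc _ ≤ ∑ _i : Fin r, (1 + F * δ) ^ 2 := Finset.sum_le_sum fun i _ =>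
          pow_le_pow_left₀ (colNorm_nonneg _) (hcol i) 2
      _ = _ := by simp
  have hle' : F ≤ √r * (1 + F * δ) := le_of_sq_le_sq hle (by positivity)
  have hlin : F * (8 * r - 1) ≤ √r * (8 * r) := by
    nlinarith [mul_le_mul_of_nonneg_left hδ hF0]
  have hsq : F ^ 2 * (8 * r - 1) ^ 2 ≤ r * (8 * r) ^ 2 := by
    have := pow_le_pow_left₀ (mul_nonneg hF0 (by linarith)) hlin 2
    rwa [mul_pow, mul_pow, hs] at this
  rw [← hFsq]
  have hpos : (0 : ℝ) < (8 * r - 1) ^ 2 := by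
    have : (0 : ℝ) < 8 * r - 1 := by linarith
    positivity
  refine le_of_mul_le_mul_right (hsq.trans ?_) hpos
  nlinarith

lemma exp_neg_le_det_of_optimal {r n : ℕ} (hr : 2 ≤ r) {W Q : Matrix (Fin r) (Fin r) ℝ}
    {Mt Z : Matrix (Fin r) (Fin n) ℝ} {δ : ℝ} (hδ0 : 0 ≤ δ) (hδ : δ * (8 * r * √r) ≤ 1)
    (hW : IsUnit W.det) (hMt : Mt = W * Z) (hZ : ∀ j, colNorm (Zᵀ j) ≤ 1 + δ)
    (hA : SDPOptimal Mt (Qᵀ * Q)) :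
    Real.exp (-(1 / 4)) ≤ ((Q * W)ᵀ * (Q * W)).det := by
  set c : ℝ := (1 + δ)⁻¹ with hc
  have hc0 : 0 < c := by positivity
  have hfeas : SDPFeasible Mt ((c • W⁻¹)ᵀ * (c • W⁻¹)) := by
    refine ⟨by simpa using Matrix.posSemidef_conjTranspose_mul_self (c • W⁻¹), fun j => ?_⟩
    have hcol : (fun i => Mt i j) = W *ᵥ Zᵀ j := by
      subst hMt; rfl
    rw [← colNorm_mulVec_sq, hcol, Matrix.mulVec_mulVec, Matrix.smul_mul,
      Matrix.nonsing_inv_mul W hW, Matrix.smul_mulVec, Matrix.one_mulVec, colNorm_smul,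
      abs_of_pos hc0]
    refine pow_le_one₀ (mul_nonneg hc0.le (colNorm_nonneg _)) ?_
    rw [hc, inv_mul_le_iff₀ (by positivity), mul_one]
    exact hZ j
  have hdet := hA.2 _ hfeas
  simp only [Matrix.det_mul, Matrix.det_transpose, Matrix.det_smul, Fintype.card_fin] at hdet ⊢
  have hinv : W⁻¹.det * W.det = 1 := by
    rw [← Matrix.det_mul, Matrix.nonsing_inv_mul W hW, Matrix.det_one]
  have hpow : (c ^ r) ^ 2 ≤ Q.det * W.det * (Q.det * W.det) := by
    have := mul_le_mul_of_nonneg_right hdet (sq_nonneg W.det)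
    calc (c ^ r) ^ 2 = c ^ r * W⁻¹.det * (c ^ r * W⁻¹.det) * W.det ^ 2 := by
          linear_combination (-(c ^ r) ^ 2 * (W⁻¹.det * W.det + 1)) * hinv
      _ ≤ _ := this
      _ = _ := by ring
  refine le_trans ?_ hpow
  have hce : Real.exp (-δ) ≤ c := by
    rw [Real.exp_neg]
    exact inv_anti₀ (by positivity) (by linarith [Real.add_one_le_exp δ])
  have hs : 1 ≤ √(r : ℝ) := Real.one_le_sqrt.2 (by exact_mod_cast (by omega : 1 ≤ r))
  have hrδ : 0 ≤ δ * (8 * r) := by positivity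
  calc Real.exp (-(1 / 4)) ≤ Real.exp (((r * 2 : ℕ) : ℝ) * -δ) := by
        apply Real.exp_le_exp.2
        push_cast
        nlinarith
    _ = Real.exp (-δ) ^ (r * 2) := Real.exp_nat_mul _ _
    _ ≤ c ^ (r * 2) := pow_le_pow_left₀ (Real.exp_pos _).le hce _
    _ = (c ^ r) ^ 2 := pow_mul _ _ _

lemma colNorm_mul_bounds {r n : ℕ} {W : Matrix (Fin r) (Fin r) ℝ}
    {H N Mt : Matrix (Fin r) (Fin n) ℝ} {ε : ℝ} {Q : Matrix (Fin r) (Fin r) ℝ}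
    (hr : 2 ≤ r) (hsep : NearSepSquare r n W H N Mt ε)
    (hε : ε ≤ sigmaMin W / (8 * r * √r)) (hA : SDPOptimal Mt (Qᵀ * Q)) (v : Fin r → ℝ) :
    1 / √10 * colNorm v ≤ colNorm ((Q * W) *ᵥ v) ∧ colNorm ((Q * W) *ᵥ v) ≤ 2 * colNorm v := by
  obtain ⟨hW, hMt, hH, hHsum, ⟨hrn, hHid⟩, -, hN⟩ := hsep
  have hσ : 0 < sigmaMin W := sigmaMin_pos (by omega) hW
  have hr0 : (0 : ℝ) < r := by exact_mod_cast (by omega : 0 < r)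
  have hd : 0 < 8 * r * √(r : ℝ) := by positivity
  set δ : ℝ := 1 / (8 * r * √r) with hδdef
  have hδ0 : 0 ≤ δ := by positivity
  have hδ : δ * (8 * r * √r) ≤ 1 := (div_mul_cancel₀ 1 hd.ne').le
  have hWE : W * (W⁻¹ * N) = N := Matrix.mul_nonsing_inv_cancel_left W N hW
  set E := W⁻¹ * N
  have hE : ∀ j, colNorm (Eᵀ j) ≤ δ := fun j => by
    have hcol : W *ᵥ Eᵀ j = fun i => N i j := by
      rw [← hWE]; rfl
    refine le_of_mul_le_mul_left ?_ hσ
    calc sigmaMin W * colNorm (Eᵀ j) ≤ ε := (sigmaMin_mul_le W _).trans (hcol ▸ hN j)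
      _ ≤ sigmaMin W * δ := by rwa [hδdef, mul_one_div]
  have hMt' : Mt = W * (H + E) := by rw [Matrix.mul_add, hWE, hMt]
  have hZ : ∀ j, colNorm ((H + E)ᵀ j) ≤ 1 + δ := fun j =>
    (colNorm_add_le (Hᵀ j) (Eᵀ j)).trans
      (add_le_add ((colNorm_le_sum fun i => hH i j).trans (hHsum j)) (hE j))
  have hdet := exp_neg_le_det_of_optimal hr hδ0 hδ hW hMt' hZ hA
  have htr : ((Q * W)ᵀ * (Q * W)).trace ≤ r + 3 / 10 := by
    refine trace_le_of_colNorm_le hr hδ (fun i => hE (Fin.castLE hrn i)) fun i => ?_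
    have hcol : W *ᵥ (Pi.single i 1 + Eᵀ (Fin.castLE hrn i)) =
        fun k => Mt k (Fin.castLE hrn i) := by
      have hid : Pi.single i 1 = Hᵀ (Fin.castLE hrn i) := by
        ext k
        rw [Matrix.transpose_apply, hHid, Pi.single_apply]
      rw [hid, hMt']; rfl
    rw [← Matrix.mulVec_mulVec, hcol, ← sq_le_one_iff₀ (colNorm_nonneg _), colNorm_mulVec_sq]
    exact hA.1.2 _
  have hC : ((Q * W)ᵀ * (Q * W)).PosSemidef := by
    simpa using Matrix.posSemidef_conjTranspose_mul_self (Q * W)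
  obtain ⟨h1, h2⟩ := quadForm_bounds_of_eigenvalues hC.1
    (eigenvalues_mem_Icc_of_trace_det hC htr hdet) v
  rw [← colNorm_mulVec_sq, ← colNorm_sq] at h1 h2
  constructor
  · refine le_of_sq_le_sq ?_ (colNorm_nonneg _)
    rwa [mul_pow, div_pow, Real.sq_sqrt (by norm_num), one_pow]
  · refine le_of_sq_le_sq ?_ (by linarith [colNorm_nonneg v])
    rw [mul_pow]
    linarith

/-- Bounds on the preconditioner `Q` with `QᵀQ = A*` where `A*` is an optimal solution of the
minimum-volume-ellipsoid SDP: `σ_min(QW) ≥ 1/√10`, `κ(QW) ≤ √40`,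
`σ_min(Q) ≥ 1/(√10 σ_max(W))`, `σ_max(Q) ≤ 2/σ_min(W)` and `κ(Q) ≤ 2√10 κ(W)`. -/
theorem preconditioner_bounds (r n : ℕ) (W : Matrix (Fin r) (Fin r) ℝ)
    (H : Matrix (Fin r) (Fin n) ℝ) (N Mt : Matrix (Fin r) (Fin n) ℝ) (ε : ℝ)
    (A Q : Matrix (Fin r) (Fin r) ℝ)
    (hr : 2 ≤ r) (hsep : NearSepSquare r n W H N Mt ε)
    (hε : ε ≤ sigmaMin W / (8 * r * Real.sqrt r)) (hA : SDPOptimal Mt A)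
    (hQ : Qᵀ * Q = A) :
    1 / Real.sqrt 10 ≤ sigmaMin (Q * W) ∧
    kappa (Q * W) ≤ Real.sqrt 40 ∧
    1 / (Real.sqrt 10 * sigmaMax W) ≤ sigmaMin Q ∧
    sigmaMax Q ≤ 2 / sigmaMin W ∧
    kappa Q ≤ 2 * Real.sqrt 10 * kappa W := by
  subst hQ
  have hr0 : 0 < r := by omega
  have hW := hsep.1
  have hσ := sigmaMin_pos hr0 hW
  have hσ' := hσ.trans_le (sigmaMin_le_sigmaMax hr0 W)
  have h10 : 0 < √(10 : ℝ) := by positivity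
  have hb := colNorm_mul_bounds hr hsep hε hA
  have hQv : ∀ v, (Q * W) *ᵥ W⁻¹ *ᵥ v = Q *ᵥ v := fun v => by
    rw [Matrix.mulVec_mulVec, Matrix.mul_nonsing_inv_cancel_right W Q hW]
  have hWv : ∀ v, W *ᵥ W⁻¹ *ᵥ v = v := fun v => by
    rw [Matrix.mulVec_mulVec, Matrix.mul_nonsing_inv W hW, Matrix.one_mulVec]
  have hmin : 1 / √10 ≤ sigmaMin (Q * W) := le_sigmaMin hr0 fun v => (hb v).1
  have hmax : sigmaMax (Q * W) ≤ 2 := sigmaMax_le hr0 fun v => (hb v).2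
  have hQmin : 1 / (√10 * sigmaMax W) ≤ sigmaMin Q := le_sigmaMin hr0 fun v => by
    have h1 := (hb (W⁻¹ *ᵥ v)).1
    have h2 := le_sigmaMax_mul W (W⁻¹ *ᵥ v)
    rw [hQv] at h1
    rw [hWv] at h2
    refine le_trans ?_ h1
    rw [one_div_mul_eq_div, one_div_mul_eq_div, ← div_div, div_right_comm]
    gcongr
    rwa [div_le_iff₀' hσ']
  have hQmax : sigmaMax Q ≤ 2 / sigmaMin W := sigmaMax_le hr0 fun v => by
    have h1 := (hb (W⁻¹ *ᵥ v)).2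
    have h2 := sigmaMin_mul_le W (W⁻¹ *ᵥ v)
    rw [hQv] at h1
    rw [hWv] at h2
    refine h1.trans ?_
    rw [div_mul_eq_mul_div, mul_div_assoc]
    gcongr
    rwa [le_div_iff₀' hσ]
  refine ⟨hmin, ?_, hQmin, hQmax, ?_⟩
  · have h40 : √(40 : ℝ) = 2 / (1 / √10) := by
      rw [show (40 : ℝ) = 2 ^ 2 * 10 by norm_num, Real.sqrt_mul (by norm_num),
        Real.sqrt_sq (by norm_num), div_div_eq_mul_div, div_one]
    rw [h40]
    exact div_le_div₀ (by norm_num) hmax (by positivity) hmin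
  · calc kappa Q ≤ 2 / sigmaMin W / (1 / (√10 * sigmaMax W)) :=
          div_le_div₀ (by positivity) hQmax (by positivity) hQmin
      _ = 2 * √10 * kappa W := by
          rw [kappa]
          field_simp
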